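/- Let L > 0 and Ra ∈ ℝ, and let (θ', θ̄, u, v, w, ω, ψ) be a smooth solution of the infinite-Prandtl-number convection system on ℝ³ × [0,∞) (as specified in the context). Then for every t ≥ 0 the energy identity holds: (1/2) ‖θ'(·,t)‖₂² + ∫₀^t ‖∇_h θ'(·,s)‖₂² ds + 4π²L² ∫₀^t ∫₀^{2π} |∂_z θ̄(z,s)|² dz ds = (1/2) ‖θ'(·,0)‖₂². -/

import Mathlib

noncomputable section
open Real

/-- Functions of `(x, y, z, t)`. -/
abbrev F4 := ℝ → ℝ → ℝ → ℝ → ℝ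

def px (f : F4) : F4 := fun x y z t => deriv (fun s => f s y z t) x
def py (f : F4) : F4 := fun x y z t => deriv (fun s => f x s z t) y
def pz (f : F4) : F4 := fun x y z t => deriv (fun s => f x y s t) z
def pt (f : F4) : F4 := fun x y z t => deriv (fun s => f x y z s) t

/-- Horizontal Laplacian `Δ_h = ∂²_x + ∂²_y`. -/
def lapH (f : F4) : F4 := fun x y z t => px (px f) x y z t + py (py f) x y z t

/-- The horizontal mean `(1/(4π²L²)) ∫_{[0,2πL]²} f dx dy`. -/
def hmean (L : ℝ) (f : F4) (z t : ℝ) : ℝ :=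
  (1/(4*π^2*L^2)) * ∫ y in (0:ℝ)..(2*π*L), ∫ x in (0:ℝ)..(2*π*L), f x y z t

/-- Smoothness on `ℝ³ × D` (jointly in all four variables). -/
def SmoothF4 (f : F4) (D : Set ℝ) : Prop :=
  ContDiffOn ℝ (⊤ : ℕ∞) (fun p : ℝ × ℝ × ℝ × ℝ => f p.1 p.2.1 p.2.2.1 p.2.2.2)
    {p : ℝ × ℝ × ℝ × ℝ | p.2.2.2 ∈ D}

/-- Spatial periodicity: period `2πL` in `x` and `y`, period `2π` in `z`. -/
def PeriodicF4 (L : ℝ) (f : F4) : Prop :=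
  (∀ x y z t, f (x + 2*π*L) y z t = f x y z t) ∧
  (∀ x y z t, f x (y + 2*π*L) z t = f x y z t) ∧
  (∀ x y z t, f x y (z + 2*π) t = f x y z t)

/-- A smooth solution of the infinite-Prandtl-number rapidly rotating convection system
on `ℝ³ × D`. -/
structure IsSolution (L Ra : ℝ) (D : Set ℝ)
    (θ' : F4) (θb : ℝ → ℝ → ℝ) (u v w ω ψ : F4) : Prop where
  smooth_θ' : SmoothF4 θ' D
  smooth_u : SmoothF4 u D
  smooth_v : SmoothF4 v D
  smooth_w : SmoothF4 w D
  smooth_ω : SmoothF4 ω D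
  smooth_ψ : SmoothF4 ψ D
  smooth_θb : ContDiffOn ℝ (⊤ : ℕ∞) (fun p : ℝ × ℝ => θb p.1 p.2) {p : ℝ × ℝ | p.2 ∈ D}
  per_θ' : PeriodicF4 L θ'
  per_u : PeriodicF4 L u
  per_v : PeriodicF4 L v
  per_w : PeriodicF4 L w
  per_ω : PeriodicF4 L ω
  per_ψ : PeriodicF4 L ψ
  per_θb : ∀ z t, θb (z + 2*π) t = θb z t
  /-- `∂_z ψ = Ra θ' + Δ_h w` -/
  eq_psi : ∀ x y z : ℝ, ∀ t ∈ D, pz ψ x y z t = Ra * θ' x y z t + lapH w x y z t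
  /-- `−∂_z w = Δ_h ω` -/
  eq_w : ∀ x y z : ℝ, ∀ t ∈ D, -pz w x y z t = lapH ω x y z t
  /-- `∂_t θ' + u ∂_x θ' + v ∂_y θ' + w ∂_z θ̄ = Δ_h θ'` -/
  eq_heat : ∀ x y z : ℝ, ∀ t ∈ D,
    pt θ' x y z t + u x y z t * px θ' x y z t + v x y z t * py θ' x y z t
      + w x y z t * deriv (fun s => θb s t) z = lapH θ' x y z t
  /-- `∂_z (mean of θ' w) = ∂²_z θ̄` -/
  eq_mean : ∀ z : ℝ, ∀ t ∈ D,
    deriv (fun s => hmean L (fun x y z' t' => θ' x y z' t' * w x y z' t') s t) z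
      = deriv (deriv (fun s => θb s t)) z
  /-- `∂_x u + ∂_y v = 0` -/
  div_free : ∀ x y z : ℝ, ∀ t ∈ D, px u x y z t + py v x y z t = 0
  /-- `ω = ∂_x v − ∂_y u` -/
  def_ω : ∀ x y z : ℝ, ∀ t ∈ D, ω x y z t = px v x y z t - py u x y z t
  /-- `Δ_h ψ = ω` -/
  def_ψ : ∀ x y z : ℝ, ∀ t ∈ D, lapH ψ x y z t = ω x y z t
  /-- `u = −∂_y ψ` -/
  def_u : ∀ x y z : ℝ, ∀ t ∈ D, u x y z t = -py ψ x y z t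
  /-- `v = ∂_x ψ` -/
  def_v : ∀ x y z : ℝ, ∀ t ∈ D, v x y z t = px ψ x y z t
  mean_θ' : ∀ z : ℝ, ∀ t ∈ D, hmean L θ' z t = 0
  mean_u : ∀ z : ℝ, ∀ t ∈ D, hmean L u z t = 0
  mean_v : ∀ z : ℝ, ∀ t ∈ D, hmean L v z t = 0
  mean_w : ∀ z : ℝ, ∀ t ∈ D, hmean L w z t = 0
  mean_ω : ∀ z : ℝ, ∀ t ∈ D, hmean L ω z t = 0
  mean_ψ : ∀ z : ℝ, ∀ t ∈ D, hmean L ψ z t = 0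
  mean_θb : ∀ t ∈ D, (∫ z in (0:ℝ)..(2*π), θb z t) = 0

/-- Integral over `Ω = [0,2πL]² × [0,2π]` at time `t`. -/
def intOmega (L : ℝ) (g : F4) (t : ℝ) : ℝ :=
  ∫ z in (0:ℝ)..(2*π), ∫ y in (0:ℝ)..(2*π*L), ∫ x in (0:ℝ)..(2*π*L), g x y z t

open Set MeasureTheory

lemma intervalIntegral_swap_of_continuous {f : ℝ → ℝ → ℝ} (hf : Continuous (Function.uncurry f))
    (a b c d : ℝ) :
    ∫ x in a..b, ∫ y in c..d, f x y = ∫ y in c..d, ∫ x in a..b, f x y := by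
  apply intervalIntegral_intervalIntegral_swap
  exact (hf.continuousOn.integrableOn_compact (isCompact_uIcc.prod isCompact_uIcc)).mono_set
    (prod_mono uIoc_subset_uIcc uIoc_subset_uIcc)

lemma continuous_intervalIntegral_left {f : ℝ → ℝ → ℝ} (hf : Continuous (Function.uncurry f))
    (a b : ℝ) : Continuous fun y => ∫ x in a..b, f x y := by
  apply intervalIntegral.continuous_parametric_intervalIntegral_of_continuous'
  exact hf.comp continuous_swap

/-- The set on which a function smooth on `ℝ³ × [0,∞)` is controlled. -/
abbrev halfSpace : Set (ℝ × ℝ × ℝ × ℝ) := {p | p.2.2.2 ∈ Ici (0 : ℝ)}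

lemma uniqueDiffOn_halfSpace : UniqueDiffOn ℝ halfSpace := by
  have h : halfSpace = univ ×ˢ univ ×ˢ univ ×ˢ Ici (0 : ℝ) := by
    ext p; simp [halfSpace]
  rw [h]
  exact uniqueDiffOn_univ.prod (uniqueDiffOn_univ.prod
    (uniqueDiffOn_univ.prod (uniqueDiffOn_Ici 0)))

namespace SmoothF4

variable {f g : F4}

lemma add {D : Set ℝ} (hf : SmoothF4 f D) (hg : SmoothF4 g D) :
    SmoothF4 (fun x y z t => f x y z t + g x y z t) D := ContDiffOn.add hf hg

lemma sub {D : Set ℝ} (hf : SmoothF4 f D) (hg : SmoothF4 g D) :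
    SmoothF4 (fun x y z t => f x y z t - g x y z t) D := ContDiffOn.sub hf hg

lemma mul {D : Set ℝ} (hf : SmoothF4 f D) (hg : SmoothF4 g D) :
    SmoothF4 (fun x y z t => f x y z t * g x y z t) D := ContDiffOn.mul hf hg

lemma pow {D : Set ℝ} (hf : SmoothF4 f D) (n : ℕ) :
    SmoothF4 (fun x y z t => f x y z t ^ n) D := ContDiffOn.pow hf n

lemma const_mul {D : Set ℝ} (c : ℝ) (hf : SmoothF4 f D) :
    SmoothF4 (fun x y z t => c * f x y z t) D := contDiffOn_const.mul hf

lemma continuous_comp {X : Type*} [TopologicalSpace X] (hf : SmoothF4 f (Ici 0))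
    {a b c d : X → ℝ} (ha : Continuous a) (hb : Continuous b) (hc : Continuous c)
    (hd : Continuous d) (h0 : ∀ p, 0 ≤ d p) :
    Continuous fun p => f (a p) (b p) (c p) (d p) :=
  ContDiffOn.continuousOn hf |>.comp_continuous
    (ha.prodMk (hb.prodMk (hc.prodMk hd))) h0

lemma hasDerivAt_comp (hf : SmoothF4 f (Ici 0)) {γ : ℝ → ℝ × ℝ × ℝ × ℝ}
    {e : ℝ × ℝ × ℝ × ℝ} {s : ℝ} (hγ : HasDerivAt γ e s) (hmem : ∀ r, γ r ∈ halfSpace) :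
    HasDerivAt (fun r => f (γ r).1 (γ r).2.1 (γ r).2.2.1 (γ r).2.2.2)
      (fderivWithin ℝ (fun p : ℝ × ℝ × ℝ × ℝ => f p.1 p.2.1 p.2.2.1 p.2.2.2) halfSpace (γ s) e)
      s := by
  have h := (ContDiffOn.differentiableOn hf (by simp) (γ s) (hmem s)).hasFDerivWithinAt
  have h2 := h.comp_hasDerivWithinAt (s := univ) s hγ.hasDerivWithinAt (fun r _ => hmem r)
  exact h2.hasDerivAt Filter.univ_mem

lemma fderivWithin_apply (hf : SmoothF4 f (Ici 0)) (e : ℝ × ℝ × ℝ × ℝ) :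
    ContDiffOn ℝ (⊤ : ℕ∞) (fun q => fderivWithin ℝ
      (fun p : ℝ × ℝ × ℝ × ℝ => f p.1 p.2.1 p.2.2.1 p.2.2.2) halfSpace q e) halfSpace :=
  (ContDiffOn.fderivWithin hf uniqueDiffOn_halfSpace (by simp)).clm_apply contDiffOn_const


lemma hasDerivAt_px_aux (hf : SmoothF4 f (Ici 0)) (x y z : ℝ) {t : ℝ} (ht : 0 ≤ t) :
    HasDerivAt (fun s => f s y z t) (fderivWithin ℝ
      (fun p : ℝ × ℝ × ℝ × ℝ => f p.1 p.2.1 p.2.2.1 p.2.2.2) halfSpace (x, y, z, t) (1, 0)) x :=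
  hf.hasDerivAt_comp (γ := fun s => (s, y, z, t))
    ((hasDerivAt_id x).prodMk (hasDerivAt_const x (y, z, t))) (fun _ => ht)

lemma hasDerivAt_py_aux (hf : SmoothF4 f (Ici 0)) (x y z : ℝ) {t : ℝ} (ht : 0 ≤ t) :
    HasDerivAt (fun s => f x s z t) (fderivWithin ℝ
      (fun p : ℝ × ℝ × ℝ × ℝ => f p.1 p.2.1 p.2.2.1 p.2.2.2) halfSpace (x, y, z, t)
        (0, 1, 0)) y :=
  hf.hasDerivAt_comp (γ := fun s => (x, s, z, t))
    ((hasDerivAt_const y x).prodMk ((hasDerivAt_id y).prodMk (hasDerivAt_const y (z, t))))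
    (fun _ => ht)

lemma hasDerivAt_pz_aux (hf : SmoothF4 f (Ici 0)) (x y z : ℝ) {t : ℝ} (ht : 0 ≤ t) :
    HasDerivAt (fun s => f x y s t) (fderivWithin ℝ
      (fun p : ℝ × ℝ × ℝ × ℝ => f p.1 p.2.1 p.2.2.1 p.2.2.2) halfSpace (x, y, z, t)
        (0, 0, 1, 0)) z :=
  hf.hasDerivAt_comp (γ := fun s => (x, y, s, t))
    ((hasDerivAt_const z x).prodMk ((hasDerivAt_const z y).prodMk
      ((hasDerivAt_id z).prodMk (hasDerivAt_const z t)))) (fun _ => ht)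

lemma hasDerivAt_px (hf : SmoothF4 f (Ici 0)) (x y z : ℝ) {t : ℝ} (ht : 0 ≤ t) :
    HasDerivAt (fun s => f s y z t) (px f x y z t) x :=
  (hf.hasDerivAt_px_aux x y z ht).differentiableAt.hasDerivAt

lemma hasDerivAt_py (hf : SmoothF4 f (Ici 0)) (x y z : ℝ) {t : ℝ} (ht : 0 ≤ t) :
    HasDerivAt (fun s => f x s z t) (py f x y z t) y :=
  (hf.hasDerivAt_py_aux x y z ht).differentiableAt.hasDerivAt

lemma hasDerivAt_pz (hf : SmoothF4 f (Ici 0)) (x y z : ℝ) {t : ℝ} (ht : 0 ≤ t) :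
    HasDerivAt (fun s => f x y s t) (pz f x y z t) z :=
  (hf.hasDerivAt_pz_aux x y z ht).differentiableAt.hasDerivAt

lemma hasDerivAt_pt (hf : SmoothF4 f (Ici 0)) (x y z : ℝ) {t : ℝ} (ht : 0 < t) :
    HasDerivAt (fun s => f x y z s) (pt f x y z t) t := by
  have hn : halfSpace ∈ nhds (x, y, z, t) :=
    (continuous_snd.snd.snd.tendsto (x, y, z, t)).eventually (Ici_mem_nhds ht)
  have hd := (ContDiffOn.contDiffAt hf hn).differentiableAt (by simp)
  have hγ : DifferentiableAt ℝ (fun s : ℝ => (x, y, z, s)) t := by fun_prop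
  exact (DifferentiableAt.comp t hd hγ).hasDerivAt

lemma px (hf : SmoothF4 f (Ici 0)) : SmoothF4 (px f) (Ici 0) :=
  (hf.fderivWithin_apply (1, 0)).congr fun p hp =>
    (hf.hasDerivAt_px_aux p.1 p.2.1 p.2.2.1 hp).deriv

lemma py (hf : SmoothF4 f (Ici 0)) : SmoothF4 (py f) (Ici 0) :=
  (hf.fderivWithin_apply (0, 1, 0)).congr fun p hp =>
    (hf.hasDerivAt_py_aux p.1 p.2.1 p.2.2.1 hp).deriv

lemma pz (hf : SmoothF4 f (Ici 0)) : SmoothF4 (pz f) (Ici 0) :=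
  (hf.fderivWithin_apply (0, 0, 1, 0)).congr fun p hp =>
    (hf.hasDerivAt_pz_aux p.1 p.2.1 p.2.2.1 hp).deriv

lemma lapH (hf : SmoothF4 f (Ici 0)) : SmoothF4 (lapH f) (Ici 0) :=
  hf.px.px.add hf.py.py

end SmoothF4

/-- The integral over the horizontal cell `[0,2πL]²`. -/
def cellIntegral (L : ℝ) (f : F4) (z t : ℝ) : ℝ :=
  ∫ y in (0:ℝ)..(2*π*L), ∫ x in (0:ℝ)..(2*π*L), f x y z t

section CellIntegral

variable {f g : F4} (L : ℝ)

lemma continuous_cellIntegral_comp {X : Type*} [TopologicalSpace X] (hf : SmoothF4 f (Ici 0))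
    {c d : X → ℝ} (hc : Continuous c) (hd : Continuous d) (h0 : ∀ p, 0 ≤ d p) :
    Continuous fun p => cellIntegral L f (c p) (d p) := by
  unfold cellIntegral
  apply intervalIntegral.continuous_parametric_intervalIntegral_of_continuous'
  apply intervalIntegral.continuous_parametric_intervalIntegral_of_continuous'
  exact hf.continuous_comp (by fun_prop) (by fun_prop) (by fun_prop) (by fun_prop)
    (fun p => h0 _)

lemma continuous_intOmega_comp {X : Type*} [TopologicalSpace X] (hf : SmoothF4 f (Ici 0))
    {d : X → ℝ} (hd : Continuous d) (h0 : ∀ p, 0 ≤ d p) :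
    Continuous fun p => intOmega L f (d p) := by
  apply intervalIntegral.continuous_parametric_intervalIntegral_of_continuous'
  exact continuous_cellIntegral_comp L hf (by fun_prop) (by fun_prop) (fun p => h0 _)

lemma SmoothF4.continuous_x (hf : SmoothF4 f (Ici 0)) (y z : ℝ) {t : ℝ} (ht : 0 ≤ t) :
    Continuous fun x => f x y z t :=
  hf.continuous_comp (by fun_prop) (by fun_prop) (by fun_prop) (by fun_prop) (fun _ => ht)

lemma SmoothF4.continuous_integral_x (hf : SmoothF4 f (Ici 0)) (a b z : ℝ) {t : ℝ}
    (ht : 0 ≤ t) : Continuous fun y => ∫ x in a..b, f x y z t := by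
  apply intervalIntegral.continuous_parametric_intervalIntegral_of_continuous'
  exact hf.continuous_comp (by fun_prop) (by fun_prop) (by fun_prop) (by fun_prop) (fun _ => ht)

lemma cellIntegral_add (hf : SmoothF4 f (Ici 0)) (hg : SmoothF4 g (Ici 0)) (z : ℝ) {t : ℝ}
    (ht : 0 ≤ t) :
    cellIntegral L (fun x y z t => f x y z t + g x y z t) z t
      = cellIntegral L f z t + cellIntegral L g z t := by
  unfold cellIntegral
  rw [← intervalIntegral.integral_add
    ((hf.continuous_integral_x _ _ z ht).intervalIntegrable _ _)
    ((hg.continuous_integral_x _ _ z ht).intervalIntegrable _ _)]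
  congr with y
  exact intervalIntegral.integral_add ((hf.continuous_x y z ht).intervalIntegrable _ _)
    ((hg.continuous_x y z ht).intervalIntegrable _ _)

lemma cellIntegral_const_mul (c : ℝ) (z t : ℝ) :
    cellIntegral L (fun x y z t => c * f x y z t) z t = c * cellIntegral L f z t := by
  simp only [cellIntegral, intervalIntegral.integral_const_mul]

lemma hmean_eq_cellIntegral (z t : ℝ) :
    hmean L f z t = 1 / (4 * π ^ 2 * L ^ 2) * cellIntegral L f z t := rfl

lemma cellIntegral_px (hf : SmoothF4 f (Ici 0))
    (hper : ∀ x y z t, f (x + 2 * π * L) y z t = f x y z t) (z : ℝ) {t : ℝ} (ht : 0 ≤ t) :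
    cellIntegral L (px f) z t = 0 := by
  have h (y : ℝ) : ∫ x in (0:ℝ)..(2*π*L), px f x y z t = 0 := by
    rw [intervalIntegral.integral_eq_sub_of_hasDerivAt
      (fun x _ => hf.hasDerivAt_px x y z ht) ((hf.px.continuous_x y z ht).intervalIntegrable _ _)]
    simpa [sub_eq_zero] using hper 0 y z t
  simp [cellIntegral, h]

lemma cellIntegral_py (hf : SmoothF4 f (Ici 0))
    (hper : ∀ x y z t, f x (y + 2 * π * L) z t = f x y z t) (z : ℝ) {t : ℝ} (ht : 0 ≤ t) :
    cellIntegral L (py f) z t = 0 := by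
  have h (x : ℝ) : ∫ y in (0:ℝ)..(2*π*L), py f x y z t = 0 := by
    rw [intervalIntegral.integral_eq_sub_of_hasDerivAt
      (fun y _ => hf.hasDerivAt_py x y z ht)
      ((hf.py.continuous_comp (by fun_prop) (by fun_prop) (by fun_prop) (by fun_prop)
        (fun _ => ht)).intervalIntegrable _ _)]
    simpa [sub_eq_zero] using hper x 0 z t
  unfold cellIntegral
  rw [intervalIntegral_swap_of_continuous]
  · simp [h]
  · exact hf.py.continuous_comp (by fun_prop) (by fun_prop) (by fun_prop) (by fun_prop)
      (fun _ => ht)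

/-- Differentiation under the integral sign, in the vertical variable. -/
lemma hasDerivAt_cellIntegral (hf : SmoothF4 f (Ici 0)) (z : ℝ) {t : ℝ} (ht : 0 ≤ t) :
    HasDerivAt (fun s => cellIntegral L f s t) (cellIntegral L (pz f) z t) z := by
  have key (s : ℝ) : cellIntegral L f s t
      = cellIntegral L f 0 t + ∫ r in (0:ℝ)..s, cellIntegral L (pz f) r t := by
    have hx (x y : ℝ) : f x y s t = f x y 0 t + ∫ r in (0:ℝ)..s, pz f x y r t := by
      rw [intervalIntegral.integral_eq_sub_of_hasDerivAt
        (fun r _ => hf.hasDerivAt_pz x y r ht)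
        ((hf.pz.continuous_comp (by fun_prop) (by fun_prop) (by fun_prop) (by fun_prop)
        (fun _ => ht)).intervalIntegrable _ _)]
      ring
    have hy (y : ℝ) : ∫ x in (0:ℝ)..(2*π*L), f x y s t = (∫ x in (0:ℝ)..(2*π*L), f x y 0 t)
        + ∫ r in (0:ℝ)..s, ∫ x in (0:ℝ)..(2*π*L), pz f x y r t := by
      rw [intervalIntegral_swap_of_continuous, ← intervalIntegral.integral_add
        ((hf.continuous_x y 0 ht).intervalIntegrable _ _)]
      · simp only [hx _ y]
      · refine (intervalIntegral.continuous_parametric_intervalIntegral_of_continuous' ?_ _ _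
          ).intervalIntegrable _ _
        exact hf.pz.continuous_comp (by fun_prop) (by fun_prop) (by fun_prop) (by fun_prop)
          (fun _ => ht)
      · exact hf.pz.continuous_comp (by fun_prop) (by fun_prop) (by fun_prop) (by fun_prop)
          (fun _ => ht)
    have hc : Continuous (Function.uncurry fun r y => ∫ x in (0:ℝ)..(2*π*L), pz f x y r t) := by
      apply intervalIntegral.continuous_parametric_intervalIntegral_of_continuous'
      exact hf.pz.continuous_comp (by fun_prop) (by fun_prop) (by fun_prop) (by fun_prop)
        (fun _ => ht)
    unfold cellIntegral
    rw [intervalIntegral_swap_of_continuous hc, ← intervalIntegral.integral_add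
      ((hf.continuous_integral_x _ _ 0 ht).intervalIntegrable _ _)]
    · simp only [hy]
    · exact (continuous_intervalIntegral_left hc _ _).intervalIntegrable _ _
  rw [funext key]
  have hc : Continuous fun r => cellIntegral L (pz f) r t :=
    continuous_cellIntegral_comp L hf.pz (by fun_prop) (by fun_prop) (fun _ => ht)
  exact (intervalIntegral.integral_hasDerivAt_right (hc.intervalIntegrable _ _)
    (hc.stronglyMeasurableAtFilter _ _) hc.continuousAt).const_add _

/-- The fundamental theorem of calculus for the integral over `Ω` of a time-dependent function. -/
lemma intOmega_sub_eq_integral (hf : SmoothF4 f (Ici 0)) (hg : SmoothF4 g (Ici 0))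
    (hfg : ∀ x y z t, 0 < t → HasDerivAt (fun s => f x y z s) (g x y z t) t)
    {t : ℝ} (ht : 0 ≤ t) :
    intOmega L f t = intOmega L f 0 + ∫ s in (0:ℝ)..t, intOmega L g s := by
  have hmax (F : ℝ → ℝ) : ∫ s in (0:ℝ)..t, F s = ∫ s in (0:ℝ)..t, F (max s 0) := by
    apply intervalIntegral.integral_congr
    intro s hs
    rw [uIcc_of_le ht] at hs
    simp [max_eq_left hs.1]
  have hx (x y z : ℝ) : f x y z t = f x y z 0 + ∫ s in (0:ℝ)..t, g x y z (max s 0) := by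
    rw [← hmax (fun s => g x y z s), intervalIntegral.integral_eq_sub_of_hasDerivAt_of_le ht
      (f := fun s => f x y z s) _ (fun s hs => hfg x y z s hs.1)]
    · ring
    · refine ContinuousOn.intervalIntegrable ?_
      rw [uIcc_of_le ht]
      exact (ContDiffOn.continuousOn hg).comp (f := fun s : ℝ => (x, y, z, s)) (by fun_prop)
        (fun s hs => hs.1)
    · exact (ContDiffOn.continuousOn hf).comp (f := fun s : ℝ => (x, y, z, s)) (by fun_prop)
        (fun s hs => hs.1)
  have hy (y z : ℝ) : ∫ x in (0:ℝ)..(2*π*L), f x y z t = (∫ x in (0:ℝ)..(2*π*L), f x y z 0)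
      + ∫ s in (0:ℝ)..t, ∫ x in (0:ℝ)..(2*π*L), g x y z (max s 0) := by
    have hc : Continuous (Function.uncurry fun s x => g x y z (max s 0)) :=
      hg.continuous_comp (by fun_prop) (by fun_prop) (by fun_prop) (by fun_prop) (by simp)
    rw [intervalIntegral_swap_of_continuous hc, ← intervalIntegral.integral_add
      ((hf.continuous_x y z le_rfl).intervalIntegrable _ _)]
    · simp only [hx _ y z]
    · exact (continuous_intervalIntegral_left hc _ _).intervalIntegrable _ _
  have hz (z : ℝ) : cellIntegral L f z t = cellIntegral L f z 0
      + ∫ s in (0:ℝ)..t, cellIntegral L g z (max s 0) := by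
    have hc : Continuous (Function.uncurry fun s y => ∫ x in (0:ℝ)..(2*π*L),
        g x y z (max s 0)) := by
      apply intervalIntegral.continuous_parametric_intervalIntegral_of_continuous'
      exact hg.continuous_comp (by fun_prop) (by fun_prop) (by fun_prop) (by fun_prop) (by simp)
    unfold cellIntegral
    rw [intervalIntegral_swap_of_continuous hc, ← intervalIntegral.integral_add
      ((hf.continuous_integral_x _ _ z le_rfl).intervalIntegrable _ _)]
    · simp only [hy _ z]
    · exact (continuous_intervalIntegral_left hc _ _).intervalIntegrable _ _
  have hc : Continuous (Function.uncurry fun s z => cellIntegral L g z (max s 0)) :=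
    continuous_cellIntegral_comp L hg (by fun_prop) (by fun_prop) (by simp)
  rw [hmax]
  change ∫ z in (0:ℝ)..(2*π), cellIntegral L f z t = (∫ z in (0:ℝ)..(2*π), cellIntegral L f z 0)
    + ∫ s in (0:ℝ)..t, ∫ z in (0:ℝ)..(2*π), cellIntegral L g z (max s 0)
  rw [intervalIntegral_swap_of_continuous hc, ← intervalIntegral.integral_add]
  · simp only [hz]
  · exact (continuous_cellIntegral_comp L hf (by fun_prop) (by fun_prop)
      (fun _ => le_rfl)).intervalIntegrable _ _
  · exact (continuous_intervalIntegral_left hc _ _).intervalIntegrable _ _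

end CellIntegral

namespace IsSolution

variable {L Ra : ℝ} {θ' : F4} {θb : ℝ → ℝ → ℝ} {u v w ω ψ : F4}

lemma smoothF4_θb (h : IsSolution L Ra (Ici 0) θ' θb u v w ω ψ) :
    SmoothF4 (fun _ _ z t => θb z t) (Ici 0) :=
  h.smooth_θb.comp (g := fun p : ℝ × ℝ => θb p.1 p.2)
    (f := fun p : ℝ × ℝ × ℝ × ℝ => (p.2.2.1, p.2.2.2)) (by fun_prop) (fun _ hp => hp)

/-- The mean convective flux and the mean temperature gradient differ by a function of time. -/
lemma exists_cellIntegral_flux_eq (h : IsSolution L Ra (Ici 0) θ' θb u v w ω ψ) (hL : 0 < L)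
    {t : ℝ} (ht : 0 ≤ t) :
    ∃ c, ∀ z, cellIntegral L (fun x y z t => θ' x y z t * w x y z t) z t
      = 4 * π ^ 2 * L ^ 2 * (deriv (fun s => θb s t) z + c) := by
  have hflux := h.smooth_θ'.mul h.smooth_w
  have hd1 (z : ℝ) : DifferentiableAt ℝ
      (fun s => hmean L (fun x y z' t' => θ' x y z' t' * w x y z' t') s t) z :=
    (hasDerivAt_cellIntegral L hflux z ht).differentiableAt.const_mul _
  have hd2 (z : ℝ) : DifferentiableAt ℝ (deriv (fun s => θb s t)) z :=
    (h.smoothF4_θb.pz.hasDerivAt_pz 0 0 z ht).differentiableAt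
  set m := fun s => hmean L (fun x y z' t' => θ' x y z' t' * w x y z' t') s t with hm
  have hconst := is_const_of_deriv_eq_zero (f := fun z => m z - deriv (fun s => θb s t) z)
    (fun z => (hd1 z).sub (hd2 z))
    (fun z => by
      rw [deriv_fun_sub (hd1 z) (hd2 z), h.eq_mean z t ht, sub_self])
  refine ⟨m 0 - deriv (fun s => θb s t) 0, fun z => ?_⟩
  rw [← hconst z 0, add_sub_cancel]
  have : (4 * π ^ 2 * L ^ 2) ≠ 0 := by positivity
  simp only [hm, hmean_eq_cellIntegral]
  field_simp

lemma integral_flux_mul_deriv (h : IsSolution L Ra (Ici 0) θ' θb u v w ω ψ) (hL : 0 < L)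
    {t : ℝ} (ht : 0 ≤ t) :
    ∫ z in (0:ℝ)..(2*π), deriv (fun s => θb s t) z
        * cellIntegral L (fun x y z t => θ' x y z t * w x y z t) z t
      = 4 * π ^ 2 * L ^ 2 * ∫ z in (0:ℝ)..(2*π), deriv (fun s => θb s t) z ^ 2 := by
  obtain ⟨c, hc⟩ := h.exists_cellIntegral_flux_eq hL ht
  have hcont : Continuous (deriv (fun s => θb s t)) :=
    h.smoothF4_θb.pz.continuous_comp (a := fun _ => 0) (b := fun _ => 0)
      continuous_const continuous_const continuous_id continuous_const (fun _ => ht)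
  have h0 : ∫ z in (0:ℝ)..(2*π), deriv (fun s => θb s t) z = 0 := by
    rw [intervalIntegral.integral_deriv_eq_sub
      (fun z _ => (h.smoothF4_θb.hasDerivAt_pz 0 0 z ht).differentiableAt)
      (hcont.intervalIntegrable _ _)]
    simpa [sub_eq_zero] using h.per_θb 0 t
  have hpt (z : ℝ) : deriv (fun s => θb s t) z
        * cellIntegral L (fun x y z t => θ' x y z t * w x y z t) z t
      = 4 * π ^ 2 * L ^ 2 * (deriv (fun s => θb s t) z ^ 2 + c * deriv (fun s => θb s t) z) := by
    rw [hc]; ring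
  have hsq : Continuous fun z => deriv (fun s => θb s t) z ^ 2 := hcont.pow 2
  simp only [hpt]
  rw [intervalIntegral.integral_const_mul, intervalIntegral.integral_add
    (hsq.intervalIntegrable _ _) ((hcont.const_mul c).intervalIntegrable _ _),
    intervalIntegral.integral_const_mul, h0, mul_zero, add_zero]

/-- The right-hand side of `∂_t (θ'² / 2)` given by the heat equation. -/
def energyRate (θ' : F4) (θb : ℝ → ℝ → ℝ) (u v w : F4) : F4 := fun x y z t =>
  θ' x y z t * (lapH θ' x y z t - (u x y z t * px θ' x y z t + v x y z t * py θ' x y z t)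
    - w x y z t * pz (fun _ _ z t => θb z t) x y z t)

lemma smoothF4_energyRate (h : IsSolution L Ra (Ici 0) θ' θb u v w ω ψ) :
    SmoothF4 (energyRate θ' θb u v w) (Ici 0) :=
  h.smooth_θ'.mul ((h.smooth_θ'.lapH.sub ((h.smooth_u.mul h.smooth_θ'.px).add
    (h.smooth_v.mul h.smooth_θ'.py))).sub (h.smooth_w.mul h.smoothF4_θb.pz))

/-- The energy rate as a horizontal divergence minus dissipation and mean flux terms. -/
lemma energyRate_eq (h : IsSolution L Ra (Ici 0) θ' θb u v w ω ψ) (x y z : ℝ) {t : ℝ}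
    (ht : 0 ≤ t) :
    energyRate θ' θb u v w x y z t
      = px (fun x y z t => θ' x y z t * px θ' x y z t - 1/2 * (u x y z t * θ' x y z t ^ 2)) x y z t
        + py (fun x y z t => θ' x y z t * py θ' x y z t - 1/2 * (v x y z t * θ' x y z t ^ 2))
            x y z t
        + ((-1) * (px θ' x y z t ^ 2 + py θ' x y z t ^ 2)
          + (-deriv (fun s => θb s t) z) * (θ' x y z t * w x y z t)) := by
  have hx : px (fun x y z t => θ' x y z t * px θ' x y z t
      - 1/2 * (u x y z t * θ' x y z t ^ 2)) x y z t = _ :=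
    (((h.smooth_θ'.hasDerivAt_px x y z ht).mul (h.smooth_θ'.px.hasDerivAt_px x y z ht)).sub
      (((h.smooth_u.hasDerivAt_px x y z ht).mul
        ((h.smooth_θ'.hasDerivAt_px x y z ht).pow 2)).const_mul (1/2))).deriv
  have hy : py (fun x y z t => θ' x y z t * py θ' x y z t
      - 1/2 * (v x y z t * θ' x y z t ^ 2)) x y z t = _ :=
    (((h.smooth_θ'.hasDerivAt_py x y z ht).mul (h.smooth_θ'.py.hasDerivAt_py x y z ht)).sub
      (((h.smooth_v.hasDerivAt_py x y z ht).mul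
        ((h.smooth_θ'.hasDerivAt_py x y z ht).pow 2)).const_mul (1/2))).deriv
  have hdiv := h.div_free x y z t ht
  rw [hx, hy]
  simp only [energyRate, lapH, pz, Pi.pow_apply]
  push_cast
  linear_combination (1/2 * θ' x y z t ^ 2) * hdiv

lemma cellIntegral_energyRate (h : IsSolution L Ra (Ici 0) θ' θb u v w ω ψ) (z : ℝ) {t : ℝ}
    (ht : 0 ≤ t) :
    cellIntegral L (energyRate θ' θb u v w) z t
      = -cellIntegral L (fun x y z t => px θ' x y z t ^ 2 + py θ' x y z t ^ 2) z t
        - deriv (fun s => θb s t) z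
          * cellIntegral L (fun x y z t => θ' x y z t * w x y z t) z t := by
  have hθ := h.smooth_θ'
  have hA := (hθ.mul hθ.px).sub ((h.smooth_u.mul (hθ.pow 2)).const_mul (1/2))
  have hB := (hθ.mul hθ.py).sub ((h.smooth_v.mul (hθ.pow 2)).const_mul (1/2))
  have hG := (hθ.px.pow 2).add (hθ.py.pow 2)
  have hF := hθ.mul h.smooth_w
  have hpx (x y z t : ℝ) : px θ' (x + 2 * π * L) y z t = px θ' x y z t := by
    simp only [px]
    rw [← deriv_comp_add_const]
    simp only [h.per_θ'.1]
  have hpy (x y z t : ℝ) : py θ' x (y + 2 * π * L) z t = py θ' x y z t := by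
    simp only [py]
    rw [← deriv_comp_add_const]
    simp only [h.per_θ'.2.1]
  have hA0 := cellIntegral_px L hA
    (fun x y z t => by simp only [hpx, h.per_θ'.1, h.per_u.1]) z ht
  have hB0 := cellIntegral_py L hB
    (fun x y z t => by simp only [hpy, h.per_θ'.2.1, h.per_v.2.1]) z ht
  calc cellIntegral L (energyRate θ' θb u v w) z t
      = cellIntegral L (fun x y z t' =>
        px (fun x y z t => θ' x y z t * px θ' x y z t
          - 1/2 * (u x y z t * θ' x y z t ^ 2)) x y z t'
        + py (fun x y z t => θ' x y z t * py θ' x y z t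
          - 1/2 * (v x y z t * θ' x y z t ^ 2)) x y z t'
        + ((-1) * (px θ' x y z t' ^ 2 + py θ' x y z t' ^ 2)
          + (-deriv (fun s => θb s t') z) * (θ' x y z t' * w x y z t'))) z t := by
        simp only [cellIntegral, h.energyRate_eq _ _ z ht]
    _ = _ := by
        rw [cellIntegral_add L (hA.px.add hB.py) ((hG.const_mul (-1)).add
          (f := fun x y z t => (-1) * (px θ' x y z t ^ 2 + py θ' x y z t ^ 2))
          ?_) z ht, cellIntegral_add L hA.px hB.py z ht, hA0, hB0,
          cellIntegral_add L (hG.const_mul (-1)) ?_ z ht, cellIntegral_const_mul]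
        · have : cellIntegral L (fun x y z t =>
              (-deriv (fun s => θb s t) z) * (θ' x y z t * w x y z t)) z t
              = (-deriv (fun s => θb s t) z)
                * cellIntegral L (fun x y z t => θ' x y z t * w x y z t) z t := by
            simp only [cellIntegral, intervalIntegral.integral_const_mul]
          rw [this]
          ring
        all_goals
          have := (h.smoothF4_θb.pz.const_mul (-1)).mul hF
          simpa only [pz, neg_one_mul] using this

lemma intOmega_energyRate (h : IsSolution L Ra (Ici 0) θ' θb u v w ω ψ) (hL : 0 < L) {t : ℝ}
    (ht : 0 ≤ t) :
    intOmega L (energyRate θ' θb u v w) t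
      = -intOmega L (fun x y z t => px θ' x y z t ^ 2 + py θ' x y z t ^ 2) t
        - 4 * π ^ 2 * L ^ 2 * ∫ z in (0:ℝ)..(2*π), deriv (fun s => θb s t) z ^ 2 := by
  have hG := (h.smooth_θ'.px.pow 2).add (h.smooth_θ'.py.pow 2)
  have hF := h.smooth_θ'.mul h.smooth_w
  have hcont : Continuous (deriv (fun s => θb s t)) :=
    h.smoothF4_θb.pz.continuous_comp (a := fun _ => 0) (b := fun _ => 0)
      continuous_const continuous_const continuous_id continuous_const (fun _ => ht)
  rw [← h.integral_flux_mul_deriv hL ht]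
  change ∫ z in (0:ℝ)..(2*π), cellIntegral L (energyRate θ' θb u v w) z t
    = -(∫ z in (0:ℝ)..(2*π),
        cellIntegral L (fun x y z t => px θ' x y z t ^ 2 + py θ' x y z t ^ 2) z t) - _
  rw [← intervalIntegral.integral_neg, ← intervalIntegral.integral_sub]
  · simp only [h.cellIntegral_energyRate _ ht]
  · exact (continuous_cellIntegral_comp L hG continuous_id continuous_const
      (fun _ => ht)).neg.intervalIntegrable _ _
  · exact (hcont.mul (continuous_cellIntegral_comp L hF continuous_id continuous_const
      (fun _ => ht))).intervalIntegrable _ _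

lemma hasDerivAt_half_sq (h : IsSolution L Ra (Ici 0) θ' θb u v w ω ψ) (x y z : ℝ) {t : ℝ}
    (ht : 0 < t) :
    HasDerivAt (fun s => 1/2 * θ' x y z s ^ 2) (energyRate θ' θb u v w x y z t) t := by
  refine (((h.smooth_θ'.hasDerivAt_pt x y z ht).pow 2).const_mul (1/2)).congr_deriv ?_
  have := h.eq_heat x y z t ht.le
  simp only [energyRate, pz]
  push_cast
  linear_combination θ' x y z t * this

end IsSolution

/-- Energy identity for smooth solutions of the infinite-Prandtl-number convection system. -/
theorem energy_identity (L Ra : ℝ) (hL : 0 < L)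
    (θ' : F4) (θb : ℝ → ℝ → ℝ) (u v w ω ψ : F4)
    (hsol : IsSolution L Ra (Set.Ici 0) θ' θb u v w ω ψ) :
    ∀ t : ℝ, 0 ≤ t →
      (1/2) * intOmega L (fun x y z s => (θ' x y z s)^2) t
        + (∫ s in (0:ℝ)..t,
            intOmega L (fun x y z s' => (px θ' x y z s')^2 + (py θ' x y z s')^2) s)
        + 4*π^2*L^2 * ∫ s in (0:ℝ)..t,
            ∫ z in (0:ℝ)..(2*π), (deriv (fun z' => θb z' s) z)^2
      = (1/2) * intOmega L (fun x y z s => (θ' x y z s)^2) 0 := by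
  intro t ht
  have hG := (hsol.smooth_θ'.px.pow 2).add (hsol.smooth_θ'.py.pow 2)
  have hmain := intOmega_sub_eq_integral L ((hsol.smooth_θ'.pow 2).const_mul (1/2))
    hsol.smoothF4_energyRate (fun x y z t ht => hsol.hasDerivAt_half_sq x y z ht) ht
  have hhalf (s : ℝ) : intOmega L (fun x y z t => 1/2 * θ' x y z t ^ 2) s
      = 1/2 * intOmega L (fun x y z t => θ' x y z t ^ 2) s := by
    simp only [intOmega, intervalIntegral.integral_const_mul]
  have hcG : ContinuousOn (fun s => intOmega L
      (fun x y z s' => (px θ' x y z s')^2 + (py θ' x y z s')^2) s) (Ici 0) := by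
    rw [continuousOn_iff_continuous_domRestrict]
    exact continuous_intOmega_comp L hG continuous_subtype_val (fun p => p.2)
  have hcT : ContinuousOn (fun s => ∫ z in (0:ℝ)..(2*π), (deriv (fun z' => θb z' s) z)^2)
      (Ici 0) := by
    rw [continuousOn_iff_continuous_domRestrict]
    apply intervalIntegral.continuous_parametric_intervalIntegral_of_continuous'
    exact (hsol.smoothF4_θb.pz.pow 2).continuous_comp (a := fun _ => 0) (b := fun _ => 0)
      continuous_const continuous_const continuous_snd
      (continuous_subtype_val.comp continuous_fst) (fun p => p.1.2)
  have hsub : uIcc 0 t ⊆ Ici 0 := by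
    rw [uIcc_of_le ht]; exact Icc_subset_Ici_self
  have hrate : ∫ s in (0:ℝ)..t, intOmega L (IsSolution.energyRate θ' θb u v w) s
      = -(∫ s in (0:ℝ)..t,
            intOmega L (fun x y z s' => (px θ' x y z s')^2 + (py θ' x y z s')^2) s)
        - 4*π^2*L^2 * ∫ s in (0:ℝ)..t,
            ∫ z in (0:ℝ)..(2*π), (deriv (fun z' => θb z' s) z)^2 := by
    rw [← intervalIntegral.integral_const_mul, ← intervalIntegral.integral_neg,
      ← intervalIntegral.integral_sub (hcG.mono hsub).fun_neg.intervalIntegrable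
        ((hcT.mono hsub).const_mul _).intervalIntegrable]
    exact intervalIntegral.integral_congr fun s hs => hsol.intOmega_energyRate hL (hsub hs)
  rw [hhalf, hhalf, hrate] at hmain
  linarith
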